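/- Let V be a real scalar product space and T a linear operator on V. Then T is self-adjoint if and only if V admits a metric-Jordan decomposition for T, i.e. V = V_1 ⊥ ⋯ ⊥ V_k is an orthogonal direct sum of T-invariant subspaces (each necessarily nondegenerate) where each V_i either has a basis v_1,…,v_p forming a skew-normal sequence of sign ε_i = ±1 with T v_j = λ v_j + v_{j+1} for some λ ∈ ℝ (v_{p+1} := 0), or has a basis u_1,v_1,…,u_p,v_p with ⟨u_i,u_j⟩ = 1 = −⟨v_i,v_j⟩ whenever i+j = p+1, all other scalar products among the basis vectors zero, and T u_j = a u_j − b v_j + u_{j+1}, T v_j = b u_j + a v_j + v_{j+1} for some a,b ∈ ℝ with b ≠ 0 (u_{p+1} := 0, v_{p+1} := 0). -/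

import Mathlib

section MetricJordan

variable {V : Type*} [AddCommGroup V] [Module ℝ V]

/-- A real metric-Jordan block for the bilinear form `B` and operator `T` with data
`(lam, p, ε)`: a subspace with a basis `v 1, …, v p` forming a skew-normal sequence of
sign `ε = ±1` such that `T (v j) = lam • v j + v (j+1)` (with `v (p+1) = 0`). -/
def IsRealBlock (B : V →ₗ[ℝ] V →ₗ[ℝ] ℝ) (T : Module.End ℝ V)
    (lam : ℝ) (p : ℕ) (ε : ℝ) (W : Submodule ℝ V) : Prop :=
  0 < p ∧ (ε = 1 ∨ ε = -1) ∧
  ∃ v : ℕ → V,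
    v (p + 1) = 0 ∧
    (∀ j, 1 ≤ j → j ≤ p → T (v j) = lam • v j + v (j + 1)) ∧
    (∀ i j, 1 ≤ i → i ≤ p → 1 ≤ j → j ≤ p →
      B (v i) (v j) = if i + j = p + 1 then ε else 0) ∧
    LinearIndependent ℝ (fun i : Fin p => v (i + 1)) ∧
    W = Submodule.span ℝ (v '' Set.Icc 1 p)

/-- A complex metric-Jordan block for the bilinear form `B` and operator `T` with data
`(a, b, p)`: a subspace with a basis `u 1, v 1, …, u p, v p` with
`B (u i) (u j) = 1 = - B (v i) (v j)` when `i + j = p + 1`, all other scalar products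
zero, and `T (u j) = a • u j - b • v j + u (j+1)`,
`T (v j) = b • u j + a • v j + v (j+1)` (with `u (p+1) = v (p+1) = 0`). -/
def IsComplexBlock (B : V →ₗ[ℝ] V →ₗ[ℝ] ℝ) (T : Module.End ℝ V)
    (a b : ℝ) (p : ℕ) (W : Submodule ℝ V) : Prop :=
  0 < p ∧
  ∃ u v : ℕ → V,
    u (p + 1) = 0 ∧ v (p + 1) = 0 ∧
    (∀ j, 1 ≤ j → j ≤ p → T (u j) = a • u j - b • v j + u (j + 1)) ∧
    (∀ j, 1 ≤ j → j ≤ p → T (v j) = b • u j + a • v j + v (j + 1)) ∧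
    (∀ i j, 1 ≤ i → i ≤ p → 1 ≤ j → j ≤ p →
      B (u i) (u j) = if i + j = p + 1 then 1 else 0) ∧
    (∀ i j, 1 ≤ i → i ≤ p → 1 ≤ j → j ≤ p →
      B (v i) (v j) = if i + j = p + 1 then -1 else 0) ∧
    (∀ i j, 1 ≤ i → i ≤ p → 1 ≤ j → j ≤ p → B (u i) (v j) = 0) ∧
    LinearIndependent ℝ
      (Sum.elim (fun i : Fin p => u (i + 1)) (fun i : Fin p => v (i + 1))) ∧
    W = Submodule.span ℝ (u '' Set.Icc 1 p ∪ v '' Set.Icc 1 p)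

open Polynomial Module

/-- A linear functional `φ` on `F[X]` that vanishes on `X ^ k` for `k > n`, and whose value at
`X ^ n` is `ε` times a nonzero square, is normalised by precomposing with multiplication by the
square of a suitable polynomial. -/
theorem exists_polynomial_sq_mul_X_pow_eq_ite {F : Type*} [Field F] [NeZero (2 : F)]
    (φ : F[X] →ₗ[F] F) {n : ℕ} (hφ : ∀ k, n < k → φ (X ^ k) = 0) {ε d : F} (hε : ε ≠ 0)
    (hd : d ≠ 0) (hn : φ (X ^ n) = ε * d ^ 2) :
    ∃ g : F[X], ∀ k, φ (g ^ 2 * X ^ k) = if k = n then ε else 0 := by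
  have hvan (f : F[X]) (k : ℕ) (hk : n < k) : φ (f * X ^ k) = 0 := by
    induction f using Polynomial.induction_on' with
    | add p q hp hq => rw [add_mul, map_add, hp, hq, add_zero]
    | monomial m a =>
      rw [← C_mul_X_pow_eq_monomial, mul_assoc, ← pow_add, ← smul_eq_C_mul, map_smul,
        hφ _ (by omega), smul_zero]
  have key (m : ℕ) : ∃ g : F[X], ∀ k, n ≤ k + m → φ (g ^ 2 * X ^ k) = if k = n then ε else 0 := by
    induction m with
    | zero =>
      refine ⟨C d⁻¹, fun k hk ↦ ?_⟩
      rw [← C_pow, ← smul_eq_C_mul, map_smul]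
      split_ifs with h
      · subst h
        rw [hn, smul_eq_mul]
        field_simp
      · rw [hφ k (by omega), smul_zero]
    | succ m ih =>
      obtain ⟨g, hg⟩ := ih
      by_cases hm : n < m + 1
      · exact ⟨g, fun k hk ↦ hg k (by omega)⟩
      set c := φ (g ^ 2 * X ^ (n - (m + 1)))
      have h2 : (2 : F) ≠ 0 := NeZero.ne 2
      refine ⟨g * (1 + C (-c / (2 * ε)) * X ^ (m + 1)), fun k hk ↦ ?_⟩
      set t := -c / (2 * ε) with ht
      have expand : (g * (1 + C t * X ^ (m + 1))) ^ 2 * X ^ k =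
          g ^ 2 * X ^ k + (2 * t) • (g ^ 2 * X ^ (k + m + 1)) +
            (g ^ 2 * C (t ^ 2)) * X ^ (k + 2 * (m + 1)) := by
        rw [smul_eq_C_mul, C_mul, C_pow, show (C (2 : F)) = 2 from rfl]
        ring
      rw [expand, map_add, map_add, map_smul, hvan (g ^ 2 * C (t ^ 2)) _ (by omega), add_zero,
        hg (k + m + 1) (by omega)]
      by_cases hk' : k + m + 1 = n
      · rw [if_pos hk', if_neg (by omega), show k = n - (m + 1) by omega]
        change c + (2 * t) * ε = 0
        rw [ht]
        field_simp
        ring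
      · rw [if_neg hk', smul_zero, add_zero, hg k (by omega)]
  obtain ⟨g, hg⟩ := key n
  exact ⟨g, fun k ↦ hg k (by omega)⟩

section Gram

variable {B : V →ₗ[ℝ] V →ₗ[ℝ] ℝ} {ι : Type*} [Fintype ι] {b : ι → V} {σ : ι → ι}

theorem coeff_eq_zero_of_monomial_gram (h : ∀ i, B (b i) (b (σ i)) ≠ 0)
    (h' : ∀ i j, i ≠ j → B (b i) (b (σ j)) = 0) {c : ι → ℝ}
    (hc : ∀ j, B (∑ i, c i • b i) (b (σ j)) = 0) (j : ι) : c j = 0 := by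
  have := hc j
  rw [map_sum, LinearMap.sum_apply, Finset.sum_eq_single j] at this
  · simpa [h j] using this
  · intro i _ hij
    simp [h' i j hij]
  · simp

theorem linearIndependent_of_monomial_gram (h : ∀ i, B (b i) (b (σ i)) ≠ 0)
    (h' : ∀ i j, i ≠ j → B (b i) (b (σ j)) = 0) : LinearIndependent ℝ b :=
  Fintype.linearIndependent_iff.2 fun c hc ↦
    coeff_eq_zero_of_monomial_gram h h' (c := c) fun j ↦ by simp [hc]

theorem eq_zero_of_mem_span_of_monomial_gram (h : ∀ i, B (b i) (b (σ i)) ≠ 0)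
    (h' : ∀ i j, i ≠ j → B (b i) (b (σ j)) = 0) {x : V} (hx : x ∈ Submodule.span ℝ (Set.range b))
    (hxb : ∀ i, B x (b i) = 0) : x = 0 := by
  obtain ⟨c, rfl⟩ := (Submodule.mem_span_range_iff_exists_fun ℝ).1 hx
  exact Finset.sum_eq_zero fun i _ ↦ by
    rw [coeff_eq_zero_of_monomial_gram h h' (c := c) fun j ↦ hxb _, zero_smul]

end Gram

theorem image_Icc_one_eq_range_fin {α : Type*} (v : ℕ → α) (p : ℕ) :
    v '' Set.Icc 1 p = Set.range fun i : Fin p ↦ v (i + 1) := by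
  ext x
  constructor
  · rintro ⟨j, ⟨h1, h2⟩, rfl⟩
    exact ⟨⟨j - 1, by omega⟩, by simp [Nat.sub_add_cancel h1]⟩
  · rintro ⟨i, rfl⟩
    exact ⟨i + 1, ⟨by omega, by omega⟩, rfl⟩

/-- The bilinear form `B` restricts to a nondegenerate form on `W`. -/
def NondegenerateOn (B : V →ₗ[ℝ] V →ₗ[ℝ] ℝ) (W : Submodule ℝ V) : Prop :=
  ∀ x ∈ W, (∀ y ∈ W, B x y = 0) → x = 0

/-- The operator `T` is self-adjoint with respect to the bilinear form `B`. -/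
def SelfAdjointFor (B : V →ₗ[ℝ] V →ₗ[ℝ] ℝ) (T : End ℝ V) : Prop :=
  ∀ x y, B (T x) y = B x (T y)

section SkewNormal

variable {B : V →ₗ[ℝ] V →ₗ[ℝ] ℝ} {p : ℕ}

theorem skewNormal_gram_fin {v : ℕ → V} {ε : ℝ}
    (hv : ∀ i j, 1 ≤ i → i ≤ p → 1 ≤ j → j ≤ p →
      B (v i) (v j) = if i + j = p + 1 then ε else 0) (i j : Fin p) :
    B (v (i + 1)) (v (j.rev + 1)) = if i = j then ε else 0 := by
  rw [hv _ _ (by omega) (by omega) (by omega) (by omega)]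
  have : ((i : ℕ) + 1 + (j.rev + 1) = p + 1) ↔ i = j := by
    rw [Fin.val_rev, Fin.ext_iff]
    omega
  simp only [this]

theorem linearIndependent_of_skewNormal {v : ℕ → V} {ε : ℝ} (hε : ε ≠ 0)
    (hv : ∀ i j, 1 ≤ i → i ≤ p → 1 ≤ j → j ≤ p →
      B (v i) (v j) = if i + j = p + 1 then ε else 0) :
    LinearIndependent ℝ fun i : Fin p ↦ v (i + 1) :=
  linearIndependent_of_monomial_gram (B := B) (σ := Fin.rev)
    (fun i ↦ by rw [skewNormal_gram_fin hv, if_pos rfl]; exact hε)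
    fun i j hij ↦ by rw [skewNormal_gram_fin hv, if_neg hij]

variable {u v : ℕ → V}

theorem skewNormal_sum_gram (hsymm : ∀ x y, B x y = B y x)
    (hu : ∀ i j, 1 ≤ i → i ≤ p → 1 ≤ j → j ≤ p →
      B (u i) (u j) = if i + j = p + 1 then 1 else 0)
    (hv : ∀ i j, 1 ≤ i → i ≤ p → 1 ≤ j → j ≤ p →
      B (v i) (v j) = if i + j = p + 1 then -1 else 0)
    (huv : ∀ i j, 1 ≤ i → i ≤ p → 1 ≤ j → j ≤ p → B (u i) (v j) = 0) :
    let b := Sum.elim (fun i : Fin p ↦ u (i + 1)) fun i : Fin p ↦ v (i + 1)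
    (∀ i, B (b i) (b (Sum.map Fin.rev Fin.rev i)) ≠ 0) ∧
      ∀ i j, i ≠ j → B (b i) (b (Sum.map Fin.rev Fin.rev j)) = 0 := by
  refine ⟨?_, ?_⟩
  · rintro (i | i)
    · simp [skewNormal_gram_fin hu, -Fin.val_rev]
    · simp [skewNormal_gram_fin hv, -Fin.val_rev]
  · rintro (i | i) (j | j) hij
    · simpa [skewNormal_gram_fin hu, -Fin.val_rev] using hij
    · exact huv _ _ (by omega) (by omega) (by omega) (by omega)
    · exact (hsymm _ _).trans (huv _ _ (by omega) (by omega) (by omega) (by omega))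
    · simpa [skewNormal_gram_fin hv, -Fin.val_rev] using hij

end SkewNormal

theorem invariant_span {T : End ℝ V} {s : Set V} (h : ∀ x ∈ s, T x ∈ Submodule.span ℝ s) :
    ∀ x ∈ Submodule.span ℝ s, T x ∈ Submodule.span ℝ s :=
  (Submodule.span_le (p := (Submodule.span ℝ s).comap T)).2 h

theorem selfAdjoint_on_span {B : V →ₗ[ℝ] V →ₗ[ℝ] ℝ} {T : End ℝ V} {s : Set V}
    (h : ∀ x ∈ s, ∀ y ∈ s, B (T x) y = B x (T y)) :
    ∀ x ∈ Submodule.span ℝ s, ∀ y ∈ Submodule.span ℝ s, B (T x) y = B x (T y) := by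
  intro _ hx _ hy
  induction hx, hy using Submodule.span_induction₂ with
  | mem_mem x y hx hy => exact h x hx y hy
  | zero_left => simp
  | zero_right => simp
  | add_left x y z _ _ _ h1 h2 => simp [h1, h2]
  | add_right x y z _ _ _ h1 h2 => simp [h1, h2]
  | smul_left r x y _ _ h1 => simp [h1]
  | smul_right r x y _ _ h1 => simp [h1]

namespace IsRealBlock

variable {B : V →ₗ[ℝ] V →ₗ[ℝ] ℝ} {T : End ℝ V} {lam ε : ℝ} {p : ℕ} {W : Submodule ℝ V}

theorem ne_bot (h : IsRealBlock B T lam p ε W) : W ≠ ⊥ := by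
  obtain ⟨hp, hε, v, hv, hT, hB, hli, rfl⟩ := h
  rw [Submodule.ne_bot_iff]
  exact ⟨v 1, Submodule.subset_span ⟨1, ⟨le_rfl, hp⟩, rfl⟩, by simpa using hli.ne_zero ⟨0, hp⟩⟩

theorem invariant (h : IsRealBlock B T lam p ε W) : ∀ x ∈ W, T x ∈ W := by
  obtain ⟨hp, hε, v, hv, hT, hB, hli, rfl⟩ := h
  have hmem : ∀ j, 1 ≤ j → j ≤ p + 1 → v j ∈ Submodule.span ℝ (v '' Set.Icc 1 p) := by
    intro j h1 h2
    rcases Nat.lt_or_eq_of_le h2 with h2 | rfl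
    · exact Submodule.subset_span ⟨j, ⟨h1, by omega⟩, rfl⟩
    · simp [hv]
  refine invariant_span ?_
  rintro _ ⟨j, ⟨h1, h2⟩, rfl⟩
  rw [hT j h1 h2]
  exact add_mem (Submodule.smul_mem _ _ (hmem j h1 (by omega))) (hmem _ (by omega) (by omega))

theorem nondegenerateOn (h : IsRealBlock B T lam p ε W) : NondegenerateOn B W := by
  obtain ⟨hp, hε, v, hv, hT, hB, hli, rfl⟩ := h
  have hε0 : ε ≠ 0 := by rcases hε with rfl | rfl <;> norm_num
  intro x hx hxy
  rw [image_Icc_one_eq_range_fin] at hx hxy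
  exact eq_zero_of_mem_span_of_monomial_gram (σ := Fin.rev)
    (fun i ↦ by rw [skewNormal_gram_fin hB, if_pos rfl]; exact hε0)
    (fun i j hij ↦ by rw [skewNormal_gram_fin hB, if_neg hij]) hx
    fun i ↦ hxy _ (Submodule.subset_span ⟨i, rfl⟩)

theorem selfAdjoint_on (h : IsRealBlock B T lam p ε W) :
    ∀ x ∈ W, ∀ y ∈ W, B (T x) y = B x (T y) := by
  obtain ⟨hp, hε, v, hv, hT, hB, hli, rfl⟩ := h
  refine selfAdjoint_on_span ?_
  rintro _ ⟨i, ⟨hi1, hi2⟩, rfl⟩ _ ⟨j, ⟨hj1, hj2⟩, rfl⟩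
  have h1 : B (v (i + 1)) (v j) = if i + j = p then ε else 0 := by
    rcases Nat.lt_or_eq_of_le hi2 with hi | rfl
    · rw [hB _ _ (by omega) hi hj1 hj2]
      simp only [show i + 1 + j = p + 1 ↔ i + j = p by omega]
    · rw [hv, if_neg (by omega), map_zero, LinearMap.zero_apply]
  have h2 : B (v i) (v (j + 1)) = if i + j = p then ε else 0 := by
    rcases Nat.lt_or_eq_of_le hj2 with hj | rfl
    · rw [hB _ _ hi1 hi2 (by omega) hj]
      simp only [show i + (j + 1) = p + 1 ↔ i + j = p by omega]
    · rw [hv, if_neg (by omega), map_zero]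
  rw [hT i hi1 hi2, hT j hj1 hj2]
  simp [h1, h2]

theorem map {U : Type*} [AddCommGroup U] [Module ℝ U] {B' : U →ₗ[ℝ] U →ₗ[ℝ] ℝ} {T' : End ℝ U}
    {W : Submodule ℝ U} (f : U →ₗ[ℝ] V) (hf : Function.Injective f)
    (hB : ∀ x y, B (f x) (f y) = B' x y) (hT : ∀ x, T (f x) = f (T' x))
    (h : IsRealBlock B' T' lam p ε W) : IsRealBlock B T lam p ε (W.map f) := by
  obtain ⟨hp, hε, v, hv, hTv, hBv, hli, rfl⟩ := h
  refine ⟨hp, hε, f ∘ v, by simp [hv], fun j h1 h2 ↦ by simp [hT, hTv j h1 h2], ?_,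
    hli.map' f (LinearMap.ker_eq_bot.2 hf), by rw [Submodule.map_span, Set.image_comp]⟩
  simpa [hB] using hBv

end IsRealBlock

namespace IsComplexBlock

variable {B : V →ₗ[ℝ] V →ₗ[ℝ] ℝ} {T : End ℝ V} {r s : ℝ} {p : ℕ} {W : Submodule ℝ V}

theorem ne_bot (h : IsComplexBlock B T r s p W) : W ≠ ⊥ := by
  obtain ⟨hp, u, v, hu, hv, hTu, hTv, hBu, hBv, hBuv, hli, rfl⟩ := h
  rw [Submodule.ne_bot_iff]
  exact ⟨u 1, Submodule.subset_span (.inl ⟨1, ⟨le_rfl, hp⟩, rfl⟩),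
    by simpa using hli.ne_zero (.inl ⟨0, hp⟩)⟩

theorem invariant (h : IsComplexBlock B T r s p W) : ∀ x ∈ W, T x ∈ W := by
  obtain ⟨hp, u, v, hu, hv, hTu, hTv, hBu, hBv, hBuv, hli, rfl⟩ := h
  have hmemu : ∀ j, 1 ≤ j → j ≤ p + 1 →
      u j ∈ Submodule.span ℝ (u '' Set.Icc 1 p ∪ v '' Set.Icc 1 p) := by
    intro j h1 h2
    rcases Nat.lt_or_eq_of_le h2 with h2 | rfl
    · exact Submodule.subset_span (.inl ⟨j, ⟨h1, by omega⟩, rfl⟩)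
    · simp [hu]
  have hmemv : ∀ j, 1 ≤ j → j ≤ p + 1 →
      v j ∈ Submodule.span ℝ (u '' Set.Icc 1 p ∪ v '' Set.Icc 1 p) := by
    intro j h1 h2
    rcases Nat.lt_or_eq_of_le h2 with h2 | rfl
    · exact Submodule.subset_span (.inr ⟨j, ⟨h1, by omega⟩, rfl⟩)
    · simp [hv]
  refine invariant_span ?_
  rintro _ (⟨j, ⟨h1, h2⟩, rfl⟩ | ⟨j, ⟨h1, h2⟩, rfl⟩)
  · rw [hTu j h1 h2]
    exact add_mem (sub_mem (Submodule.smul_mem _ _ (hmemu j h1 (by omega)))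
      (Submodule.smul_mem _ _ (hmemv j h1 (by omega)))) (hmemu _ (by omega) (by omega))
  · rw [hTv j h1 h2]
    exact add_mem (add_mem (Submodule.smul_mem _ _ (hmemu j h1 (by omega)))
      (Submodule.smul_mem _ _ (hmemv j h1 (by omega)))) (hmemv _ (by omega) (by omega))

theorem nondegenerateOn (hsymm : ∀ x y, B x y = B y x) (h : IsComplexBlock B T r s p W) :
    NondegenerateOn B W := by
  obtain ⟨hp, u, v, hu, hv, hTu, hTv, hBu, hBv, hBuv, hli, rfl⟩ := h
  intro x hx hxy
  rw [image_Icc_one_eq_range_fin, image_Icc_one_eq_range_fin, ← Set.Sum.elim_range] at hx hxy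
  have hgram := skewNormal_sum_gram hsymm hBu hBv hBuv
  exact eq_zero_of_mem_span_of_monomial_gram hgram.1 hgram.2 hx
    fun i ↦ hxy _ (Submodule.subset_span ⟨i, rfl⟩)

theorem selfAdjoint_on (hsymm : ∀ x y, B x y = B y x) (h : IsComplexBlock B T r s p W) :
    ∀ x ∈ W, ∀ y ∈ W, B (T x) y = B x (T y) := by
  obtain ⟨hp, u, v, hu, hv, hTu, hTv, hBu, hBv, hBuv, hli, rfl⟩ := h
  have shift {w : ℕ → V} {ε : ℝ} (hw : w (p + 1) = 0)
      (hBw : ∀ i j, 1 ≤ i → i ≤ p → 1 ≤ j → j ≤ p →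
        B (w i) (w j) = if i + j = p + 1 then ε else 0)
      (i j : ℕ) (hi1 : 1 ≤ i) (hi2 : i ≤ p) (hj1 : 1 ≤ j) (hj2 : j ≤ p) :
      B (w (i + 1)) (w j) = if i + j = p then ε else 0 := by
    rcases Nat.lt_or_eq_of_le hi2 with hi | rfl
    · rw [hBw _ _ (by omega) hi hj1 hj2]
      simp only [show i + 1 + j = p + 1 ↔ i + j = p by omega]
    · rw [hw, if_neg (by omega), map_zero, LinearMap.zero_apply]
  have huv' (i j : ℕ) (hi1 : 1 ≤ i) (hi2 : i ≤ p + 1) (hj1 : 1 ≤ j) (hj2 : j ≤ p + 1) :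
      B (u i) (v j) = 0 := by
    rcases Nat.lt_or_eq_of_le hi2 with hi | rfl
    · rcases Nat.lt_or_eq_of_le hj2 with hj | rfl
      · exact hBuv _ _ hi1 (by omega) hj1 (by omega)
      · simp [hv]
    · simp [hu]
  have hvu' (i j : ℕ) (hi1 : 1 ≤ i) (hi2 : i ≤ p + 1) (hj1 : 1 ≤ j) (hj2 : j ≤ p + 1) :
      B (v i) (u j) = 0 := (hsymm _ _).trans (huv' j i hj1 hj2 hi1 hi2)
  refine selfAdjoint_on_span ?_
  rintro _ (⟨i, ⟨hi1, hi2⟩, rfl⟩ | ⟨i, ⟨hi1, hi2⟩, rfl⟩) _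
    (⟨j, ⟨hj1, hj2⟩, rfl⟩ | ⟨j, ⟨hj1, hj2⟩, rfl⟩)
  · rw [hTu i hi1 hi2, hTu j hj1 hj2]
    have h1 := shift hu hBu i j hi1 hi2 hj1 hj2
    have h2 := shift hu hBu j i hj1 hj2 hi1 hi2
    rw [hsymm, add_comm j i] at h2
    simp [h1, h2, huv' i j hi1 (by omega) hj1 (by omega), hvu' i j hi1 (by omega) hj1 (by omega)]
  · rw [hTu i hi1 hi2, hTv j hj1 hj2]
    simp [huv' i j hi1 (by omega) hj1 (by omega),
      huv' (i + 1) j (by omega) (by omega) hj1 (by omega),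
      huv' i (j + 1) hi1 (by omega) (by omega) (by omega), hBu i j hi1 hi2 hj1 hj2,
      hBv i j hi1 hi2 hj1 hj2]
    split_ifs <;> simp
  · rw [hTv i hi1 hi2, hTu j hj1 hj2]
    simp [hvu' i j hi1 (by omega) hj1 (by omega),
      hvu' (i + 1) j (by omega) (by omega) hj1 (by omega),
      hvu' i (j + 1) hi1 (by omega) (by omega) (by omega), hBu i j hi1 hi2 hj1 hj2,
      hBv i j hi1 hi2 hj1 hj2]
    split_ifs <;> simp
  · rw [hTv i hi1 hi2, hTv j hj1 hj2]
    have h1 := shift hv hBv i j hi1 hi2 hj1 hj2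
    have h2 := shift hv hBv j i hj1 hj2 hi1 hi2
    rw [hsymm, add_comm j i] at h2
    simp [h1, h2, huv' i j hi1 (by omega) hj1 (by omega), hvu' i j hi1 (by omega) hj1 (by omega)]

theorem map {U : Type*} [AddCommGroup U] [Module ℝ U] {B' : U →ₗ[ℝ] U →ₗ[ℝ] ℝ} {T' : End ℝ U}
    {W : Submodule ℝ U} (f : U →ₗ[ℝ] V) (hf : Function.Injective f)
    (hB : ∀ x y, B (f x) (f y) = B' x y) (hT : ∀ x, T (f x) = f (T' x))
    (h : IsComplexBlock B' T' r s p W) : IsComplexBlock B T r s p (W.map f) := by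
  obtain ⟨hp, u, v, hu, hv, hTu, hTv, hBu, hBv, hBuv, hli, rfl⟩ := h
  refine ⟨hp, f ∘ u, f ∘ v, by simp [hu], by simp [hv], fun j h1 h2 ↦ by simp [hT, hTu j h1 h2],
    fun j h1 h2 ↦ by simp [hT, hTv j h1 h2], by simpa [hB] using hBu, by simpa [hB] using hBv,
    by simpa [hB] using hBuv, ?_, ?_⟩
  · have hli' := hli.map' f (LinearMap.ker_eq_bot.2 hf)
    rwa [Sum.comp_elim] at hli'
  · rw [Submodule.map_span, Set.image_union, Set.image_comp, Set.image_comp]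

end IsComplexBlock

section SelfAdjointFor

variable {B : V →ₗ[ℝ] V →ₗ[ℝ] ℝ} {S T : End ℝ V}

theorem SelfAdjointFor.mul (hS : SelfAdjointFor B S) (hT : SelfAdjointFor B T)
    (h : Commute S T) : SelfAdjointFor B (S * T) := fun x y ↦ by
  rw [Module.End.mul_apply, hS, hT, h.eq, Module.End.mul_apply]

theorem SelfAdjointFor.add (hS : SelfAdjointFor B S) (hT : SelfAdjointFor B T) :
    SelfAdjointFor B (S + T) := fun x y ↦ by
  simp [hS x y, hT x y]

theorem SelfAdjointFor.smul (c : ℝ) (hT : SelfAdjointFor B T) :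
    SelfAdjointFor B (c • T) := fun x y ↦ by
  simp [hT x y]

theorem SelfAdjointFor.one : SelfAdjointFor B 1 := fun _ _ ↦ rfl

theorem SelfAdjointFor.pow (hT : SelfAdjointFor B T) (n : ℕ) : SelfAdjointFor B (T ^ n) := by
  induction n with
  | zero => exact pow_zero T ▸ .one
  | succ n ih => exact pow_succ T n ▸ ih.mul hT ((Commute.refl T).pow_left n)

theorem SelfAdjointFor.aeval (hT : SelfAdjointFor B T) (P : ℝ[X]) :
    SelfAdjointFor B (aeval T P) := by
  induction P using Polynomial.induction_on' with
  | add p q hp hq => exact map_add (Polynomial.aeval T) p q ▸ hp.add hq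
  | monomial n c =>
    rw [aeval_monomial, ← Algebra.smul_def]
    exact (hT.pow n).smul c

theorem SelfAdjointFor.exists_apply_self_ne_zero (hnondeg : ∀ x, (∀ y, B x y = 0) → x = 0)
    (hsymm : ∀ x y, B x y = B y x) (hT : SelfAdjointFor B T) (h0 : T ≠ 0) :
    ∃ x, B (T x) x ≠ 0 := by
  by_contra! h
  refine h0 (LinearMap.ext fun x ↦ hnondeg _ fun y ↦ ?_)
  have hxy := h (x + y)
  have hsw : B (T y) x = B (T x) y := by rw [hT, hsymm]
  simp only [map_add, LinearMap.add_apply, h, hsw] at hxy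
  linarith

end SelfAdjointFor

/-- If `T = lam + M` with `M ^ (n + 1) = 0`, then a vector `y` with `B (M ^ n y) y ≠ 0` gives rise
to a real metric-Jordan block of dimension `n + 1`. -/
theorem exists_isRealBlock {B : V →ₗ[ℝ] V →ₗ[ℝ] ℝ} {M T : End ℝ V} {lam : ℝ} {n : ℕ}
    (hM : SelfAdjointFor B M) (hT : T = lam • 1 + M) (hnil : M ^ (n + 1) = 0) {y : V}
    (hy : B ((M ^ n) y) y ≠ 0) : ∃ ε W, IsRealBlock B T lam (n + 1) ε W := by
  set c := B ((M ^ n) y) y with hc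
  let φ : ℝ[X] →ₗ[ℝ] ℝ :=
    B.flip y ∘ₗ LinearMap.applyₗ y ∘ₗ (Polynomial.aeval M).toLinearMap
  have hφ (f : ℝ[X]) : φ f = B (Polynomial.aeval M f y) y := rfl
  have hvan (k : ℕ) (hk : n < k) : M ^ k = 0 := pow_eq_zero_of_le hk hnil
  obtain ⟨ε, hε, d, hd, hcd⟩ : ∃ ε : ℝ, (ε = 1 ∨ ε = -1) ∧ ∃ d : ℝ, d ≠ 0 ∧ c = ε * d ^ 2 := by
    rcases lt_or_gt_of_ne hy with h | h
    · exact ⟨-1, .inr rfl, √(-c), (Real.sqrt_pos.2 (by linarith)).ne',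
        by rw [Real.sq_sqrt (by linarith)]; ring⟩
    · exact ⟨1, .inl rfl, √c, (Real.sqrt_pos.2 h).ne', by rw [Real.sq_sqrt h.le]; ring⟩
  have hε0 : ε ≠ 0 := by rcases hε with rfl | rfl <;> norm_num
  obtain ⟨g, hg⟩ := exists_polynomial_sq_mul_X_pow_eq_ite φ (n := n)
    (fun k hk ↦ by simp [hφ, hvan k hk]) hε0 hd (by simpa [hφ] using hcd)
  let v : ℕ → V := fun j ↦ Polynomial.aeval M (g * X ^ (j - 1)) y
  have hBv : ∀ i j, 1 ≤ i → i ≤ n + 1 → 1 ≤ j → j ≤ n + 1 →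
      B (v i) (v j) = if i + j = n + 1 + 1 then ε else 0 := by
    intro i j hi _ hj _
    calc B (v i) (v j) = φ (g ^ 2 * X ^ (i + j - 2)) := by
          rw [← hM.aeval, ← Module.End.mul_apply, ← map_mul, hφ,
            show i + j - 2 = (i - 1) + (j - 1) by omega]
          ring_nf
      _ = _ := by
          rw [hg]
          simp only [show i + j - 2 = n ↔ i + j = n + 1 + 1 by omega]
  refine ⟨ε, _, n.succ_pos, hε, v, by simp [v, hnil], fun j h1 h2 ↦ ?_, hBv,
    linearIndependent_of_skewNormal hε0 hBv, rfl⟩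
  obtain ⟨j, rfl⟩ := Nat.exists_eq_add_of_le' h1
  simp only [v, hT, LinearMap.add_apply, LinearMap.smul_apply, Module.End.one_apply]
  congr 1
  rw [show g * X ^ (j + 1 + 1 - 1) = X * (g * X ^ (j + 1 - 1)) by
    simp only [Nat.add_sub_cancel]; ring]
  simp

/-- The complex analogue of `exists_isRealBlock`, where `J` is a complex structure. -/
theorem exists_isComplexBlock {B : V →ₗ[ℝ] V →ₗ[ℝ] ℝ} (hsymm : ∀ x y, B x y = B y x)
    {J M T : End ℝ V} {r s : ℝ} {n : ℕ} (hM : SelfAdjointFor B M) (hJ : SelfAdjointFor B J)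
    (hJM : Commute J M) (hJJ : J * J = -1) (hT : T = r • 1 + s • J + M) (hnil : M ^ (n + 1) = 0)
    {y : V} (hy : B ((M ^ n) y) y ≠ 0) : ∃ W, IsComplexBlock B T r s (n + 1) W := by
  have hlift (z : ℂ) : Complex.lift ⟨J, hJJ⟩ z = z.re • 1 + z.im • J := by
    simp [Algebra.algebraMap_eq_smul_one]
  have hcomm (z : ℂ) : Commute (Complex.lift ⟨J, hJJ⟩ z) M := by
    rw [hlift]
    exact ((Commute.one_left M).smul_left _).add_left (hJM.smul_left _)
  let Ψ : ℂ[X] →ₐ[ℝ] End ℝ V := eval₂AlgHom (Complex.lift ⟨J, hJJ⟩) M hcomm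
  have hΨC (z : ℂ) : Ψ (C z) = z.re • 1 + z.im • J := by
    rw [← hlift]
    exact eval₂_C _ _
  have hΨX : Ψ X = M := eval₂_X _ _
  have hΨI : Ψ (C Complex.I) = J := by simp [hΨC]
  have hΨsa (f : ℂ[X]) : SelfAdjointFor B (Ψ f) := by
    induction f using Polynomial.induction_on' with
    | add p q hp hq => exact map_add Ψ p q ▸ hp.add hq
    | monomial k z =>
      rw [← C_mul_X_pow_eq_monomial, map_mul, map_pow, hΨX, hΨC]
      refine ((SelfAdjointFor.one.smul _).add (hJ.smul _)).mul (hM.pow k) ?_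
      rw [← hlift]
      exact (hcomm z).pow_right k
  let ψ : Dual ℝ ℂ[X] := B.flip y ∘ₗ LinearMap.applyₗ y ∘ₗ Ψ.toLinearMap
  let φ : ℂ[X] →ₗ[ℂ] ℂ := ψ.extendRCLike
  have hφre (f : ℂ[X]) : (φ f).re = B (Ψ f y) y := Dual.re_extendRCLike_apply (𝕜 := ℂ) ψ f
  have hφim (f : ℂ[X]) : (φ f).im = -B (Ψ (C Complex.I * f) y) y :=
    (Dual.im_extendRCLike_apply (𝕜 := ℂ) ψ f).trans (by rw [smul_eq_C_mul]; rfl)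
  have hvan (k : ℕ) (hk : n < k) : M ^ k = 0 := pow_eq_zero_of_le hk hnil
  obtain ⟨d, hd⟩ := IsAlgClosed.exists_eq_mul_self (φ (X ^ n))
  have hd0 : d ≠ 0 := by
    rintro rfl
    refine hy ?_
    have := congrArg Complex.re hd
    rw [hφre, map_pow, hΨX] at this
    simpa using this
  obtain ⟨g, hg⟩ := exists_polynomial_sq_mul_X_pow_eq_ite φ (n := n) (ε := 1) (d := d)
    (fun k hk ↦ Complex.ext (by simp [hφre, hΨX, hvan k hk]) (by simp [hφim, hΨX, hvan k hk]))
    one_ne_zero hd0 (by rw [hd]; ring)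
  let w : ℂ → ℕ → V := fun z j ↦ Ψ (C z * (g * X ^ (j - 1))) y
  have hBw (z z' : ℂ) (i j : ℕ) (hi : 1 ≤ i) (hj : 1 ≤ j) :
      B (w z i) (w z' j) = if i + j = n + 1 + 1 then (z * z').re else 0 := by
    calc B (w z i) (w z' j) = (φ ((z * z') • (g ^ 2 * X ^ (i + j - 2)))).re := by
          rw [← hΨsa, ← Module.End.mul_apply, ← map_mul, hφre,
            show i + j - 2 = (i - 1) + (j - 1) by omega, smul_eq_C_mul, C_mul]
          ring_nf
      _ = _ := by
          rw [map_smul, hg]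
          simp only [show i + j - 2 = n ↔ i + j = n + 1 + 1 by omega]
          split_ifs <;> simp
  have hend (z : ℂ) : w z (n + 1 + 1) = 0 := by
    simp [w, hΨX, hnil]
  have hMw (z : ℂ) (j : ℕ) (hj : 1 ≤ j) : M (w z j) = w z (j + 1) := by
    obtain ⟨j, rfl⟩ := Nat.exists_eq_add_of_le' hj
    simp only [w]
    rw [← hΨX, ← Module.End.mul_apply, ← map_mul, show j + 1 + 1 - 1 = j + 1 - 1 + 1 by omega,
      pow_succ]
    ring_nf
  have hJw (z : ℂ) (j : ℕ) : J (w z j) = w (Complex.I * z) j := by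
    simp only [w]
    rw [← hΨI, ← Module.End.mul_apply, ← map_mul, C_mul, mul_assoc]
  have hneg (z : ℂ) (j : ℕ) : w (-z) j = -w z j := by simp [w]
  have hBu : ∀ i j, 1 ≤ i → i ≤ n + 1 → 1 ≤ j → j ≤ n + 1 →
      B (w 1 i) (w 1 j) = if i + j = n + 1 + 1 then 1 else 0 := by
    intro i j hi _ hj _
    simp [hBw 1 1 i j hi hj]
  have hBv : ∀ i j, 1 ≤ i → i ≤ n + 1 → 1 ≤ j → j ≤ n + 1 →
      B (w (-Complex.I) i) (w (-Complex.I) j) = if i + j = n + 1 + 1 then -1 else 0 := by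
    intro i j hi _ hj _
    simp [hBw (-Complex.I) (-Complex.I) i j hi hj]
  have hBuv : ∀ i j, 1 ≤ i → i ≤ n + 1 → 1 ≤ j → j ≤ n + 1 →
      B (w 1 i) (w (-Complex.I) j) = 0 := by
    intro i j hi _ hj _
    simp [hBw 1 (-Complex.I) i j hi hj]
  have hgram := skewNormal_sum_gram hsymm hBu hBv hBuv
  refine ⟨_, n.succ_pos, w 1, w (-Complex.I), hend _, hend _, fun j h1 _ ↦ ?_, fun j h1 _ ↦ ?_,
    hBu, hBv, hBuv, linearIndependent_of_monomial_gram hgram.1 hgram.2, rfl⟩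
  · simp [hT, hMw _ j h1, hJw, hneg]
  · simp [hT, hMw _ j h1, hJw]
    abel

section Indecomposable

variable {B : V →ₗ[ℝ] V →ₗ[ℝ] ℝ} {T : End ℝ V}

theorem SelfAdjointFor.nondegenerateOn_range (hnondeg : ∀ x, (∀ y, B x y = 0) → x = 0)
    {P : End ℝ V} (hP : SelfAdjointFor B P) (hPP : P * P = P) :
    NondegenerateOn B (LinearMap.range P) := by
  rintro _ ⟨z, rfl⟩ h
  refine hnondeg _ fun y ↦ ?_
  have := h (P y) ⟨y, rfl⟩
  rwa [← hP, ← Module.End.mul_apply, hPP] at this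

/-- If `V` has no proper nonzero nondegenerate `T`-invariant subspace, then the semisimple part of
`T` is annihilated by every nonconstant divisor of its minimal polynomial. -/
theorem aeval_eq_zero_of_dvd_minpoly_of_indecomposable [FiniteDimensional ℝ V]
    (hnondeg : ∀ x, (∀ y, B x y = 0) → x = 0)
    (hind : ∀ W : Submodule ℝ V, (∀ x ∈ W, T x ∈ W) → NondegenerateOn B W → W = ⊥ ∨ W = ⊤)
    {S : End ℝ V} (hS : SelfAdjointFor B S) (hST : Commute S T) (hss : S.IsSemisimple)
    {q : ℝ[X]} (hq : q ∣ minpoly ℝ S) (hdeg : 0 < q.natDegree) : aeval S q = 0 := by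
  obtain ⟨r, hr⟩ := hq
  have hm0 : minpoly ℝ S ≠ 0 := minpoly.ne_zero_of_finite ℝ S
  have hq0 : q ≠ 0 := by rintro rfl; simp at hdeg
  have hr0 : r ≠ 0 := by rintro rfl; simp [hr] at hm0
  obtain ⟨a, b, hab⟩ : IsCoprime q r :=
    (squarefree_mul_iff.1 (hr ▸ hss.minpoly_squarefree)).1.isCoprime
  have hqr : aeval S (q * r) = 0 := by rw [← hr, minpoly.aeval]
  set P := aeval S (b * r) with hPdef
  have hone : aeval S (a * q) + P = 1 := by rw [hPdef, ← map_add, hab, map_one]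
  have hPP : P * P = P := by
    have h0 : P * aeval S (a * q) = 0 := by
      rw [hPdef, ← map_mul, show b * r * (a * q) = b * a * (q * r) by ring, map_mul, hqr, mul_zero]
    calc P * P = P * (aeval S (a * q) + P) := by rw [mul_add, h0, zero_add]
      _ = P := by rw [hone, mul_one]
  have hPT : Commute P T := by
    rw [hPdef]
    exact Algebra.commute_of_mem_adjoin_singleton_of_commute (aeval_mem_adjoin_singleton _ _)
      hST.symm |>.symm
  rcases hind (LinearMap.range P) (by
      rintro _ ⟨z, rfl⟩
      exact ⟨T z, LinearMap.congr_fun hPT.eq z⟩)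
      ((hS.aeval _).nondegenerateOn_range hnondeg hPP) with h | h
  · rw [LinearMap.range_eq_bot] at h
    have hr' : aeval S r = 0 := by
      calc aeval S r = aeval S r * (aeval S (a * q) + P) := by rw [hone, mul_one]
        _ = aeval S (a * (q * r)) := by
          rw [h, add_zero, ← map_mul]
          ring_nf
        _ = 0 := by rw [map_mul, hqr, mul_zero]
    have := natDegree_le_of_dvd (minpoly.dvd ℝ S hr') hr0
    rw [hr, natDegree_mul hq0 hr0] at this
    omega
  · have hP1 : P = 1 := by
      refine LinearMap.ext fun x ↦ ?_
      obtain ⟨z, rfl⟩ := LinearMap.range_eq_top.1 h x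
      exact LinearMap.congr_fun hPP z
    calc aeval S q = aeval S q * P := by rw [hP1, mul_one]
      _ = aeval S (b * (q * r)) := by
        rw [← map_mul]
        ring_nf
      _ = 0 := by rw [map_mul, hqr, mul_zero]

theorem exists_block_of_indecomposable [FiniteDimensional ℝ V] [Nontrivial V]
    (hsymm : ∀ x y, B x y = B y x) (hnondeg : ∀ x, (∀ y, B x y = 0) → x = 0)
    (hT : SelfAdjointFor B T)
    (hind : ∀ W : Submodule ℝ V, (∀ x ∈ W, T x ∈ W) → NondegenerateOn B W → W = ⊥ ∨ W = ⊤) :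
    (∃ lam p ε, IsRealBlock B T lam p ε ⊤) ∨ ∃ a b p, b ≠ 0 ∧ IsComplexBlock B T a b p ⊤ := by
  obtain ⟨M, hMmem, S, hSmem, hMnil, hss, hTMS⟩ := T.exists_isNilpotent_isSemisimple
  rw [Algebra.adjoin_singleton_eq_range_aeval] at hMmem hSmem
  obtain ⟨m, rfl⟩ := hMmem
  obtain ⟨s, rfl⟩ := hSmem
  set M := aeval T m
  set S := aeval T s
  change IsNilpotent M at hMnil
  change S.IsSemisimple at hss
  change T = M + S at hTMS
  have hM : SelfAdjointFor B M := hT.aeval m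
  have hS : SelfAdjointFor B S := hT.aeval s
  have hST : Commute S T := by
    simpa using (Commute.all s X).map (aeval T)
  have hSM : Commute S M := (Commute.all s m).map (aeval T)
  obtain ⟨n, hn, hn'⟩ : ∃ n, M ^ (n + 1) = 0 ∧ M ^ n ≠ 0 := by
    have hpos := pos_nilpotencyClass_iff.2 hMnil
    refine ⟨nilpotencyClass M - 1, ?_, pow_pred_nilpotencyClass hMnil⟩
    rw [Nat.sub_add_cancel hpos, pow_nilpotencyClass hMnil]
  obtain ⟨y, hy⟩ := (hM.pow n).exists_apply_self_ne_zero hnondeg hsymm hn'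
  have hann (q : ℝ[X]) := aeval_eq_zero_of_dvd_minpoly_of_indecomposable hnondeg hind hS hST hss
    (q := q)
  obtain ⟨z, hz⟩ := IsAlgClosed.exists_aeval_eq_zero ℂ (minpoly ℝ S)
    (minpoly.degree_pos (Algebra.IsIntegral.isIntegral S)).ne'
  by_cases him : z.im = 0
  · left
    have hzr : z = algebraMap ℝ ℂ z.re := Complex.ext (by simp) (by simp [him])
    have hroot : (minpoly ℝ S).IsRoot z.re := by
      rw [hzr, aeval_algebraMap_apply] at hz
      simpa using hz
    have h := hann _ (dvd_iff_isRoot.2 hroot) (by simp)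
    obtain ⟨ε, W, hW⟩ := exists_isRealBlock (T := T) (lam := z.re) hM (by
      rw [hTMS, add_comm, ← sub_eq_zero]
      simpa [Algebra.algebraMap_eq_smul_one] using h) hn hy
    obtain rfl := (hind W hW.invariant hW.nondegenerateOn).resolve_left hW.ne_bot
    exact ⟨_, _, _, hW⟩
  · right
    have h := hann _ (quadratic_dvd_of_aeval_eq_zero_im_ne_zero _ hz him) (by
      rw [show (X ^ 2 - C (2 * z.re) * X + C (‖z‖ ^ 2) : ℝ[X]).natDegree = 2 by compute_degree!]
      exact two_pos)
    set J := z.im⁻¹ • (S - z.re • 1) with hJ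
    have hnorm : ‖z‖ ^ 2 = z.re ^ 2 + z.im ^ 2 := by
      rw [Complex.sq_norm, Complex.normSq_apply]
      ring
    have hsq : (S - z.re • 1) * (S - z.re • 1) = -(z.im ^ 2) • (1 : End ℝ V) := by
      rw [map_add, map_sub, map_mul, map_pow, aeval_X, aeval_C, aeval_C, hnorm,
        Algebra.algebraMap_eq_smul_one, Algebra.algebraMap_eq_smul_one, smul_mul_assoc, one_mul,
        pow_two S] at h
      rw [← sub_eq_zero, ← h]
      simp only [mul_sub, sub_mul, smul_mul_assoc, mul_smul_comm, one_mul, mul_one]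
      module
    have hJJ : J * J = -1 := by
      rw [hJ, smul_mul_smul_comm, hsq, smul_smul, show z.im⁻¹ * z.im⁻¹ * -(z.im ^ 2) = -1 by
        field_simp]
      simp
    have hSJ : S = z.re • 1 + z.im • J := by
      rw [hJ, smul_smul, mul_inv_cancel₀ him, one_smul]
      abel
    have hJsa : SelfAdjointFor B J := by
      rw [hJ, sub_eq_add_neg, ← neg_smul]
      exact (hS.add (SelfAdjointFor.one.smul _)).smul _
    have hJM : Commute J M := (hSM.sub_left ((Commute.one_left M).smul_left _)).smul_left _
    obtain ⟨W, hW⟩ := exists_isComplexBlock (T := T) (r := z.re) (s := z.im) hsymm hM hJsa hJM hJJ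
      (by rw [← hSJ, hTMS, add_comm]) hn hy
    obtain rfl := (hind W hW.invariant (hW.nondegenerateOn hsymm)).resolve_left hW.ne_bot
    exact ⟨_, _, _, him, hW⟩

end Indecomposable

/-- An orthogonal decomposition of `V` into real and complex metric-Jordan blocks. -/
def HasMetricJordanDecomposition (B : V →ₗ[ℝ] V →ₗ[ℝ] ℝ) (T : End ℝ V) : Prop :=
  ∃ (ι : Type) (_ : Finite ι) (W : ι → Submodule ℝ V),
    (⨆ i, W i) = ⊤ ∧ (∀ i j, i ≠ j → ∀ x ∈ W i, ∀ y ∈ W j, B x y = 0) ∧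
      ∀ i, (∃ lam p ε, IsRealBlock B T lam p ε (W i)) ∨
        ∃ a b p, b ≠ 0 ∧ IsComplexBlock B T a b p (W i)

theorem HasMetricJordanDecomposition.of_isCompl {B : V →ₗ[ℝ] V →ₗ[ℝ] ℝ} {T : End ℝ V}
    (hsymm : ∀ x y, B x y = B y x) {U₁ U₂ : Submodule ℝ V} (hsup : U₁ ⊔ U₂ = ⊤)
    (horth : ∀ x ∈ U₁, ∀ y ∈ U₂, B x y = 0) (hT₁ : ∀ x ∈ U₁, T x ∈ U₁) (hT₂ : ∀ x ∈ U₂, T x ∈ U₂)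
    (h₁ : HasMetricJordanDecomposition (B.domRestrict₁₂ U₁ U₁) (T.restrict hT₁))
    (h₂ : HasMetricJordanDecomposition (B.domRestrict₁₂ U₂ U₂) (T.restrict hT₂)) :
    HasMetricJordanDecomposition B T := by
  obtain ⟨ι₁, _, W₁, hW₁, ho₁, hb₁⟩ := h₁
  obtain ⟨ι₂, _, W₂, hW₂, ho₂, hb₂⟩ := h₂
  refine ⟨ι₁ ⊕ ι₂, inferInstance,
    Sum.elim (fun i ↦ (W₁ i).map U₁.subtype) fun i ↦ (W₂ i).map U₂.subtype, ?_, ?_, ?_⟩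
  · simp only [iSup_sum, Sum.elim_inl, Sum.elim_inr, ← Submodule.map_iSup, hW₁, hW₂,
      Submodule.map_top, Submodule.range_subtype, hsup]
  · rintro (i | i) (j | j) hij _ ⟨x, hx, rfl⟩ _ ⟨y, hy, rfl⟩
    · exact ho₁ i j (by simpa using hij) x hx y hy
    · exact horth _ x.2 _ y.2
    · exact (hsymm _ _).trans (horth _ y.2 _ x.2)
    · exact ho₂ i j (by simpa using hij) x hx y hy
  · rintro (i | i)
    · refine (hb₁ i).imp ?_ ?_
      · rintro ⟨_, _, _, h⟩
        exact ⟨_, _, _, h.map _ U₁.injective_subtype (fun _ _ ↦ rfl) fun _ ↦ rfl⟩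
      · rintro ⟨_, _, _, h0, h⟩
        exact ⟨_, _, _, h0, h.map _ U₁.injective_subtype (fun _ _ ↦ rfl) fun _ ↦ rfl⟩
    · refine (hb₂ i).imp ?_ ?_
      · rintro ⟨_, _, _, h⟩
        exact ⟨_, _, _, h.map _ U₂.injective_subtype (fun _ _ ↦ rfl) fun _ ↦ rfl⟩
      · rintro ⟨_, _, _, h0, h⟩
        exact ⟨_, _, _, h0, h.map _ U₂.injective_subtype (fun _ _ ↦ rfl) fun _ ↦ rfl⟩

theorem hasMetricJordanDecomposition_of_finrank_eq (d : ℕ) :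
    ∀ (V : Type*) [AddCommGroup V] [Module ℝ V] [FiniteDimensional ℝ V]
      (B : V →ₗ[ℝ] V →ₗ[ℝ] ℝ) (T : End ℝ V), (∀ x y, B x y = B y x) →
      (∀ x, (∀ y, B x y = 0) → x = 0) → SelfAdjointFor B T → finrank ℝ V = d →
      HasMetricJordanDecomposition B T := by
  induction d using Nat.strong_induction_on with
  | _ d ih =>
  intro V _ _ _ B T hsymm hnondeg hT hd
  rcases subsingleton_or_nontrivial V with hV | hV
  · exact ⟨Empty, inferInstance, Empty.elim, Subsingleton.elim _ _, fun i ↦ i.elim,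
      fun i ↦ i.elim⟩
  by_cases hind : ∀ W : Submodule ℝ V, (∀ x ∈ W, T x ∈ W) → NondegenerateOn B W → W = ⊥ ∨ W = ⊤
  · exact ⟨Unit, inferInstance, fun _ ↦ ⊤, by simp, fun i j h ↦ (h rfl).elim,
      fun _ ↦ exists_block_of_indecomposable hsymm hnondeg hT hind⟩
  push Not at hind
  obtain ⟨U, hTU, hU, hbot, htop⟩ := hind
  set U' := LinearMap.BilinForm.orthogonal B U with hU'
  have hcompl : IsCompl U U' := by
    refine LinearMap.BilinForm.isCompl_orthogonal_of_restrict_nondegenerate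
      (fun x y h ↦ (hsymm y x).trans h) ⟨fun x hx ↦ ?_, fun x hx ↦ ?_⟩
    · exact Subtype.ext (hU x x.2 fun y hy ↦ hx ⟨y, hy⟩)
    · exact Subtype.ext (hU x x.2 fun y hy ↦ (hsymm _ _).trans (hx ⟨y, hy⟩))
  have horth : ∀ x ∈ U, ∀ y ∈ U', B x y = 0 := fun x hx y hy ↦ hy x hx
  have hTU' : ∀ x ∈ U', T x ∈ U' := fun x hx y hy ↦ by
    change B y (T x) = 0
    rw [← hT]
    exact horth _ (hTU y hy) _ hx
  have hnd' : NondegenerateOn B U' := fun x hx hxy ↦ hnondeg x fun y ↦ by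
    obtain ⟨y₁, hy₁, y₂, hy₂, rfl⟩ := Submodule.mem_sup.1 (hcompl.sup_eq_top ▸ Submodule.mem_top :
      y ∈ U ⊔ U')
    rw [map_add, hxy y₂ hy₂, hsymm, horth y₁ hy₁ x hx, add_zero]
  have hlt : finrank ℝ U < d := hd ▸ Submodule.finrank_lt htop
  have hlt' : finrank ℝ U' < d := by
    refine hd ▸ Submodule.finrank_lt fun h ↦ hbot ?_
    simpa [h] using hcompl.inf_eq_bot
  exact .of_isCompl hsymm hcompl.sup_eq_top horth hTU hTU'
    (ih _ hlt U _ _ (fun _ _ ↦ hsymm _ _)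
      (fun x hx ↦ Subtype.ext (hU x x.2 fun y hy ↦ hx ⟨y, hy⟩)) (fun _ _ ↦ hT _ _) rfl)
    (ih _ hlt' U' _ _ (fun _ _ ↦ hsymm _ _)
      (fun x hx ↦ Subtype.ext (hnd' x x.2 fun y hy ↦ hx ⟨y, hy⟩)) (fun _ _ ↦ hT _ _) rfl)

theorem eq_zero_of_forall_mem_of_iSup_eq_top {B : V →ₗ[ℝ] V →ₗ[ℝ] ℝ}
    (hnondeg : ∀ x, (∀ y, B x y = 0) → x = 0) {ι : Type*} {W : ι → Submodule ℝ V}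
    (hW : (⨆ i, W i) = ⊤) {x : V} (hx : ∀ i, ∀ y ∈ W i, B x y = 0) : x = 0 := by
  have hle : (⨆ i, W i) ≤ LinearMap.ker (B x) := iSup_le hx
  rw [hW] at hle
  exact hnondeg x fun y ↦ hle Submodule.mem_top

theorem iSupIndep_of_orthogonal {B : V →ₗ[ℝ] V →ₗ[ℝ] ℝ} (hsymm : ∀ x y, B x y = B y x)
    (hnondeg : ∀ x, (∀ y, B x y = 0) → x = 0) {ι : Type*} {W : ι → Submodule ℝ V}
    (hW : (⨆ i, W i) = ⊤) (ho : ∀ i j, i ≠ j → ∀ x ∈ W i, ∀ y ∈ W j, B x y = 0) :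
    iSupIndep W := by
  intro i
  rw [Submodule.disjoint_def]
  intro x hx hx'
  refine eq_zero_of_forall_mem_of_iSup_eq_top hnondeg hW fun j y hy ↦ ?_
  rcases eq_or_ne i j with rfl | hij
  · have hle : (⨆ k, ⨆ (_ : k ≠ i), W k) ≤ LinearMap.ker (B y) :=
      iSup₂_le fun k hk z hz ↦ ho i k hk.symm y hy z hz
    exact (hsymm x y).trans (hle hx')
  · exact ho i j hij x hx y hy

theorem selfAdjointFor_of_iSup_eq_top {B : V →ₗ[ℝ] V →ₗ[ℝ] ℝ} {T : End ℝ V} {ι : Type*}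
    {W : ι → Submodule ℝ V} (hW : (⨆ i, W i) = ⊤)
    (h : ∀ i j, ∀ x ∈ W i, ∀ y ∈ W j, B (T x) y = B x (T y)) : SelfAdjointFor B T := by
  have hspan : Submodule.span ℝ (⋃ i, (W i : Set V)) = ⊤ := by
    rw [Submodule.span_iUnion, ← hW]
    simp
  have := selfAdjoint_on_span (B := B) (T := T) (s := ⋃ i, (W i : Set V)) fun x hx y hy ↦ by
    obtain ⟨i, hi⟩ := Set.mem_iUnion.1 hx
    obtain ⟨j, hj⟩ := Set.mem_iUnion.1 hy
    exact h i j x hi y hj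
  rw [hspan] at this
  exact fun x y ↦ this x Submodule.mem_top y Submodule.mem_top

/-- **Existence of the metric-Jordan canonical form.**
A linear operator `T` on a real scalar product space `V` is self-adjoint iff `V` is an
orthogonal direct sum of `T`-invariant subspaces `W 0, …, W (k-1)`, each of which is a
real metric-Jordan block (for some `lam ∈ ℝ`, `p ≥ 1` and sign `ε = ±1`) or a complex
metric-Jordan block (for some `a, b ∈ ℝ` with `b ≠ 0` and `p ≥ 1`). -/
theorem isSelfAdjoint_iff_exists_metric_jordan_decomposition
    [FiniteDimensional ℝ V]
    (B : V →ₗ[ℝ] V →ₗ[ℝ] ℝ) (hsymm : ∀ x y, B x y = B y x)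
    (hnondeg : ∀ x, (∀ y, B x y = 0) → x = 0)
    (T : Module.End ℝ V) :
    (∀ x y, B (T x) y = B x (T y)) ↔
      ∃ (k : ℕ) (W : Fin k → Submodule ℝ V),
        (⨆ i, W i) = ⊤ ∧ iSupIndep W ∧
        (∀ i j, i ≠ j → ∀ x ∈ W i, ∀ y ∈ W j, B x y = 0) ∧
        (∀ i, ∀ x ∈ W i, T x ∈ W i) ∧
        ∀ i, (∃ lam p ε, IsRealBlock B T lam p ε (W i)) ∨
             (∃ a b p, b ≠ 0 ∧ IsComplexBlock B T a b p (W i)) := by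
  constructor
  · intro hT
    obtain ⟨ι, _, W, hW, ho, hb⟩ :=
      hasMetricJordanDecomposition_of_finrank_eq _ V B T hsymm hnondeg hT rfl
    let e := (Finite.equivFin ι).symm
    have hW' : (⨆ i, W (e i)) = ⊤ := by rw [e.iSup_comp (g := W), hW]
    have ho' : ∀ i j, i ≠ j → ∀ x ∈ W (e i), ∀ y ∈ W (e j), B x y = 0 :=
      fun i j hij ↦ ho _ _ (e.injective.ne hij)
    refine ⟨_, fun i ↦ W (e i), hW', iSupIndep_of_orthogonal hsymm hnondeg hW' ho', ho', ?_,
      fun i ↦ hb _⟩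
    intro i
    rcases hb (e i) with ⟨_, _, _, h⟩ | ⟨_, _, _, _, h⟩
    · exact h.invariant
    · exact h.invariant
  · rintro ⟨k, W, hW, -, ho, hinv, hb⟩
    refine selfAdjointFor_of_iSup_eq_top hW fun i j x hx y hy ↦ ?_
    rcases eq_or_ne i j with rfl | hij
    · rcases hb i with ⟨_, _, _, h⟩ | ⟨_, _, _, _, h⟩
      · exact h.selfAdjoint_on x hx y hy
      · exact h.selfAdjoint_on hsymm x hx y hy
    · rw [ho i j hij _ (hinv i x hx) y hy, ho i j hij x hx _ (hinv j y hy)]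

end MetricJordan
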